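/- arXiv:math/0607689 — 2 statements merged into one kernel-verified Lean document; each statement's English description precedes it below -/
import Mathlib

section
/- For every complex number r, (1/(2π)) ∫_{-π}^{π} Log(r - cos θ) dθ = Log(r + √(r+1)·√(r-1)) - log 2, where Log is the principal complex logarithm and the integral is taken over θ ∈ [-π, π] with respect to Lebesgue measure. -/
open Real Complex MeasureTheory intervalIntegral

/-- The principal complex square root, `√z = exp((1/2) Log z)` (with `√0 = 0`). -/
noncomputable def csqrt (z : ℂ) : ℂ := z ^ (1/2 : ℂ)

lemma aux_arg_lt {x : ℂ} (hx : ‖x‖ ≤ 1) : |(1 - x).arg| < π / 2 := by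
  rw [Complex.abs_arg_lt_pi_div_two_iff]
  have h1 : x.re * x.re + x.im * x.im ≤ 1 := by
    rw [← Complex.normSq_apply, Complex.normSq_eq_norm_sq]
    nlinarith [norm_nonneg x]
  by_cases h : x.re < 1
  · left
    simp only [Complex.sub_re, Complex.one_re]
    linarith
  · right
    push Not at h
    have hre : x.re = 1 := by nlinarith [mul_self_nonneg x.im]
    have him : x.im = 0 := by
      have : x.im * x.im ≤ 0 := by nlinarith
      nlinarith [mul_self_nonneg x.im, mul_self_eq_zero.mp (le_antisymm this (mul_self_nonneg x.im))]
    apply Complex.ext <;> simp [hre, him]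

lemma aux_arg_ne {x : ℂ} (hx : ‖x‖ ≤ 1) : (1 - x).arg ≠ π := by
  have h := (abs_lt.mp (aux_arg_lt hx)).2
  have := Real.pi_pos
  intro h'
  linarith

lemma aux_norm (ρ θ : ℝ) : ‖1 - (ρ : ℂ) * Complex.exp (θ * I)‖ = ‖circleMap 0 1 (-θ) - (ρ : ℂ)‖ := by
  have h : circleMap 0 1 (-θ) - (ρ : ℂ)
      = Complex.exp (((-θ : ℝ) : ℂ) * I) * (1 - (ρ : ℂ) * Complex.exp (θ * I)) := by
    rw [circleMap_zero, mul_sub, mul_left_comm, ← Complex.exp_add]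
    simp
  rw [h, norm_mul, Complex.norm_exp_ofReal_mul_I, one_mul]

lemma aux_periodic (a : ℂ) :
    Function.Periodic (fun θ : ℝ => Complex.log (1 - a * Complex.exp (θ * I))) (2 * π) := by
  intro θ
  have : Complex.exp (((θ + 2 * π : ℝ) : ℂ) * I) = Complex.exp (θ * I) := by
    push_cast
    rw [add_mul, Complex.exp_add, Complex.exp_two_pi_mul_I, mul_one]
  simp only [this]

lemma aux_lognorm_periodic (ρ : ℝ) :
    Function.Periodic (fun θ : ℝ => Real.log ‖circleMap 0 1 θ - (ρ : ℂ)‖) (2 * π) := by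
  intro θ
  simp only [periodic_circleMap 0 1 θ]

lemma aux_lognorm_int (ρ : ℝ) (a b : ℝ) :
    IntervalIntegrable (fun θ : ℝ => Real.log ‖circleMap 0 1 θ - (ρ : ℂ)‖) volume a b := by
  have h : CircleIntegrable (fun x : ℂ => Real.log ‖x - (ρ : ℂ)‖) 0 1 := by
    apply MeromorphicOn.circleIntegrable_log_norm
    intro z _
    fun_prop
  apply (aux_lognorm_periodic ρ).intervalIntegrable (t := 0) (by positivity)
  rw [zero_add]
  exact h

lemma aux_log_int_real (ρ : ℝ) (a b : ℝ) :
    IntervalIntegrable (fun θ : ℝ => Complex.log (1 - (ρ : ℂ) * Complex.exp (θ * I)))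
      volume a b := by
  have h1 : IntervalIntegrable
      (fun θ : ℝ => Real.log ‖1 - (ρ : ℂ) * Complex.exp (θ * I)‖) volume a b := by
    have := (aux_lognorm_int ρ (-a) (-b)).comp_sub_left 0
    simp only [zero_sub, neg_neg] at this
    simpa only [aux_norm] using this
  have h2 : IntervalIntegrable
      (fun θ : ℝ => (1 - (ρ : ℂ) * Complex.exp (θ * I)).arg) volume a b := by
    refine IntervalIntegrable.mono_fun' (g := fun _ => π) (by simp) ?_ ?_
    · exact (Complex.measurable_arg.comp (by fun_prop)).aestronglyMeasurable
    · filter_upwards with θ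
      exact Complex.abs_arg_le_pi _
  have h3 := (IntervalIntegrable.add (f := fun θ : ℝ =>
      ((Real.log ‖1 - (ρ : ℂ) * Complex.exp (θ * I)‖ : ℝ) : ℂ))
      (g := fun θ : ℝ => (((1 - (ρ : ℂ) * Complex.exp (θ * I)).arg : ℝ) : ℂ) * I)
      ⟨h1.1.ofReal, h1.2.ofReal⟩
      (IntervalIntegrable.mul_const ⟨h2.1.ofReal, h2.2.ofReal⟩ I))
  exact h3

lemma aux_log_zero_real (ρ : ℝ) (h0 : 0 ≤ ρ) (h1 : ρ ≤ 1) :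
    ∫ θ in (-π)..π, Complex.log (1 - (ρ : ℂ) * Complex.exp (θ * I)) = 0 := by
  set J := ∫ θ in (-π)..π, Complex.log (1 - (ρ : ℂ) * Complex.exp (θ * I)) with hJ
  have hre : J.re = 0 := by
    have := intervalIntegral.intervalIntegral_re (aux_log_int_real ρ (-π) π)
    simp only [RCLike.re_to_complex, Complex.log_re] at this
    rw [hJ, ← this]
    simp only [aux_norm]
    rw [intervalIntegral.integral_comp_neg (fun θ => Real.log ‖circleMap 0 1 θ - (ρ : ℂ)‖), neg_neg]
    have hp := (aux_lognorm_periodic ρ).intervalIntegral_add_eq (-π) 0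
    rw [show -π + 2 * π = π by ring, zero_add] at hp
    rw [hp]
    have hc := circleAverage_log_norm_sub_const_eq_posLog (a := (ρ : ℂ))
    rw [Real.circleAverage, Real.posLog_eq_zero_iff _ |>.mpr
      (by simpa [abs_of_nonneg h0] using h1)] at hc
    simpa [Real.pi_ne_zero] using hc
  have hconj : (starRingEnd ℂ) J = J := by
    rw [hJ, ← intervalIntegral.intervalIntegral_conj]
    have h := intervalIntegral.integral_comp_neg (a := -π) (b := π)
      (fun θ : ℝ => Complex.log (1 - (ρ : ℂ) * Complex.exp (θ * I)))
    rw [neg_neg] at h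
    rw [← h]
    apply intervalIntegral.integral_congr
    intro θ _
    simp only
    rw [← Complex.log_conj]
    · congr 1
      simp [← Complex.exp_conj]
    · apply aux_arg_ne
      rw [norm_mul, Complex.norm_exp_ofReal_mul_I]
      simpa [abs_of_nonneg h0] using h1
  have him : J.im = 0 := Complex.conj_eq_iff_im.mp hconj
  exact Complex.ext hre him

lemma aux_shift (a : ℂ) (θ : ℝ) : Complex.log (1 - a * Complex.exp (θ * I)) =
    Complex.log (1 - ((‖a‖ : ℝ) : ℂ) * Complex.exp (((θ + a.arg : ℝ) : ℂ) * I)) := by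
  congr 2
  conv_lhs => rw [← Complex.norm_mul_exp_arg_mul_I a]
  push_cast
  rw [add_mul, Complex.exp_add]
  ring

lemma aux_log_int (a : ℂ) (s t : ℝ) :
    IntervalIntegrable (fun θ : ℝ => Complex.log (1 - a * Complex.exp (θ * I))) volume s t := by
  simp only [aux_shift a]
  have := (aux_log_int_real ‖a‖ (s + a.arg) (t + a.arg)).comp_add_right a.arg
  simpa only [add_sub_cancel_right] using this

lemma aux_log_zero (a : ℂ) (h1 : ‖a‖ ≤ 1) :
    ∫ θ in (-π)..π, Complex.log (1 - a * Complex.exp (θ * I)) = 0 := by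
  simp only [aux_shift a]
  rw [intervalIntegral.integral_comp_add_right
    (fun θ : ℝ => Complex.log (1 - ((‖a‖ : ℝ) : ℂ) * Complex.exp (θ * I)))]
  have hp := (aux_periodic ((‖a‖ : ℝ) : ℂ)).intervalIntegral_add_eq (-π + a.arg) (-π)
  rw [show -π + a.arg + 2 * π = π + a.arg by ring, show -π + 2 * π = π by ring] at hp
  rw [hp]
  exact aux_log_zero_real _ (norm_nonneg _) h1

lemma csqrt_sq (z : ℂ) : csqrt z ^ 2 = z := by
  have := Complex.cpow_nat_inv_pow z (n := 2) (by norm_num)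
  simpa [csqrt] using this

lemma csqrt_re (z : ℂ) : 0 ≤ (csqrt z).re := by
  rw [csqrt, one_div, Complex.cpow_inv_two_re]
  positivity

lemma csqrt_im_nonneg {z : ℂ} (h : 0 ≤ z.im) : 0 ≤ (csqrt z).im := by
  rw [csqrt, one_div, Complex.cpow_inv_two_im_eq_sqrt h]
  positivity

lemma csqrt_neg {z : ℂ} (h : z.im < 0) : 0 < (csqrt z).re ∧ (csqrt z).im < 0 := by
  have h1 := congrArg Complex.im (csqrt_sq z)
  rw [pow_two, Complex.mul_im] at h1
  have h2 := csqrt_re z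
  have h3 : 0 < (csqrt z).re := by
    rcases h2.lt_or_eq with h3 | h3
    · exact h3
    · rw [← h3] at h1
      simp only [zero_mul, mul_zero, add_zero] at h1
      linarith
  refine ⟨h3, ?_⟩
  by_contra h4
  push Not at h4
  nlinarith [mul_nonneg h2 h4]

lemma w_props (r w : ℂ) (hw : w = r + csqrt (r + 1) * csqrt (r - 1)) :
    1 ≤ ‖w‖ ∧ w + w⁻¹ = 2 * r ∧ (0 ≤ r.im → 0 ≤ w.im) ∧ (r.im < 0 → w.im < 0) := by
  have hu := csqrt_sq (r + 1)
  have hv := csqrt_sq (r - 1)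
  have hur := csqrt_re (r + 1)
  have hvr := csqrt_re (r - 1)
  have hup : 0 ≤ r.im → 0 ≤ (csqrt (r + 1)).im := fun h => csqrt_im_nonneg (by simpa using h)
  have hvp : 0 ≤ r.im → 0 ≤ (csqrt (r - 1)).im := fun h => csqrt_im_nonneg (by simpa using h)
  have hun : r.im < 0 → 0 < (csqrt (r + 1)).re ∧ (csqrt (r + 1)).im < 0 :=
    fun h => csqrt_neg (by simpa using h)
  have hvn : r.im < 0 → 0 < (csqrt (r - 1)).re ∧ (csqrt (r - 1)).im < 0 :=
    fun h => csqrt_neg (by simpa using h)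
  generalize csqrt (r + 1) = u at *
  generalize csqrt (r - 1) = v at *
  have hw2 : w = (u + v) ^ 2 / 2 := by rw [hw]; linear_combination (-1/2 : ℂ) * hu - (1/2 : ℂ) * hv
  have hprod : w * ((u - v) ^ 2 / 2) = 1 := by
    have : (u ^ 2 - v ^ 2) = 2 := by rw [hu, hv]; ring
    rw [hw2]
    linear_combination (1/4 : ℂ) * (u ^ 2 - v ^ 2 + 2) * this
  have hw0 : w ≠ 0 := left_ne_zero_of_mul_eq_one hprod
  have hinv : w⁻¹ = (u - v) ^ 2 / 2 := (eq_inv_of_mul_eq_one_right hprod).symm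
  have him : w.im = (u.re + v.re) * (u.im + v.im) := by
    rw [hw2, pow_two]
    rw [show (u + v) * (u + v) / 2 = ((1/2 : ℝ) : ℂ) * ((u + v) * (u + v)) by push_cast; ring]
    rw [Complex.im_ofReal_mul, Complex.mul_im, Complex.add_re, Complex.add_im]
    ring
  refine ⟨?_, ?_, ?_, ?_⟩
  · have hi : 0 ≤ u.im * v.im := by
      rcases le_or_gt 0 r.im with h | h
      · exact mul_nonneg (hup h) (hvp h)
      · exact (mul_pos_of_neg_of_neg (hun h).2 (hvn h).2).le
    have hle : ‖w⁻¹‖ ≤ ‖w‖ := by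
      rw [hinv, hw2, norm_div, norm_div, norm_pow, norm_pow, ← Complex.normSq_eq_norm_sq,
        ← Complex.normSq_eq_norm_sq, Complex.normSq_apply, Complex.normSq_apply]
      gcongr ?_ / _
      simp only [Complex.add_re, Complex.add_im, Complex.sub_re, Complex.sub_im]
      nlinarith [mul_nonneg hur hvr]
    rw [norm_inv] at hle
    by_contra hlt
    push Not at hlt
    have hpos : 0 < ‖w‖ := norm_pos_iff.mpr hw0
    have := (one_lt_inv₀ hpos).mpr hlt
    linarith
  · rw [hinv, hw2]
    linear_combination hu + hv
  · intro h
    rw [him]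
    exact mul_nonneg (add_nonneg hur hvr) (add_nonneg (hup h) (hvp h))
  · intro h
    rw [him]
    exact mul_neg_of_pos_of_neg (add_pos (hun h).1 (hvn h).1) (add_neg (hun h).2 (hvn h).2)

lemma aux_ae (r : ℂ) : ∀ᵐ θ : ℝ, r - (Real.cos θ : ℂ) ≠ 0 := by
  have hc : {θ : ℝ | r - (Real.cos θ : ℂ) = 0}.Countable := by
    by_cases h : ∃ t : ℝ, r - (Real.cos t : ℂ) = 0
    · obtain ⟨t, ht⟩ := h
      have : {θ : ℝ | r - (Real.cos θ : ℂ) = 0} ⊆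
          (Set.range fun k : ℤ => 2 * (k : ℝ) * π + t) ∪
          (Set.range fun k : ℤ => 2 * (k : ℝ) * π - t) := by
        intro θ hθ
        have h1 : Real.cos t = Real.cos θ := by
          have : (Real.cos t : ℂ) = (Real.cos θ : ℂ) := by
            rw [← sub_eq_zero.mp ht, ← sub_eq_zero.mp hθ]
          exact_mod_cast this
        obtain ⟨k, hk | hk⟩ := Real.cos_eq_cos_iff.mp h1
        · exact Or.inl ⟨k, hk.symm⟩
        · exact Or.inr ⟨k, hk.symm⟩
      exact ((Set.countable_range _).union (Set.countable_range _)).mono this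
    · push Not at h
      simp only [h, Set.setOf_false, Set.countable_empty]
  have h0 := hc.measure_zero volume
  rw [MeasureTheory.ae_iff]
  simpa using h0

lemma aux_pointwise (r w : ℂ) (hw1 : 1 ≤ ‖w‖) (hrw : w + w⁻¹ = 2 * r)
    (hp : 0 ≤ r.im → 0 ≤ w.im) (hn : r.im < 0 → w.im < 0) (θ : ℝ)
    (hne : r - (Real.cos θ : ℂ) ≠ 0) :
    Complex.log (r - Real.cos θ) = (Complex.log w - Real.log 2) +
      (Complex.log (1 - w⁻¹ * Complex.exp (θ * I)) +
        Complex.log (1 - w⁻¹ * Complex.exp (((-θ : ℝ) : ℂ) * I))) := by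
  have hw0 : w ≠ 0 := norm_pos_iff.mp (by linarith)
  have hnorm : ∀ t : ℝ, ‖w⁻¹ * Complex.exp (t * I)‖ ≤ 1 := by
    intro t
    rw [norm_mul, Complex.norm_exp_ofReal_mul_I, mul_one, norm_inv]
    exact inv_le_one_of_one_le₀ hw1
  have hA := aux_arg_lt (hnorm θ)
  have hB := aux_arg_lt (hnorm (-θ))
  have hEE : Complex.exp (θ * I) * Complex.exp (((-θ : ℝ) : ℂ) * I) = 1 := by
    rw [← Complex.exp_add]; simp
  have hcos : (Real.cos θ : ℂ) = (Complex.exp (θ * I) + Complex.exp (((-θ : ℝ) : ℂ) * I)) / 2 := by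
    rw [Complex.ofReal_cos, Complex.cos]; push_cast; rfl
  have hfac : r - (Real.cos θ : ℂ) = w / 2 * ((1 - w⁻¹ * Complex.exp (θ * I)) *
      (1 - w⁻¹ * Complex.exp (((-θ : ℝ) : ℂ) * I))) := by
    rw [hcos]
    have hww : w * w⁻¹ = 1 := mul_inv_cancel₀ hw0
    generalize Complex.exp (θ * I) = E at *
    generalize Complex.exp (((-θ : ℝ) : ℂ) * I) = F at *
    generalize w⁻¹ = W at *
    linear_combination (-1/2 : ℂ) * hrw + (1/2 : ℂ) * (E + F - W * (E * F)) * hww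
      - (1/2 : ℂ) * W * hEE
  have hargs : |w.arg - (r - (Real.cos θ : ℂ)).arg| ≤ π := by
    have him : (r - (Real.cos θ : ℂ)).im = r.im := by simp only [Complex.sub_im, Complex.ofReal_im, sub_zero]
    rw [abs_le]
    rcases le_or_gt 0 r.im with h | h
    · have a1 := Complex.arg_nonneg_iff.mpr (hp h)
      have a2 := Complex.arg_nonneg_iff.mpr (him ▸ h)
      have a3 := Complex.arg_le_pi w
      have a4 := Complex.arg_le_pi (r - (Real.cos θ : ℂ))
      constructor <;> linarith
    · have a1 := Complex.arg_neg_iff.mpr (hn h)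
      have a2 := Complex.arg_neg_iff.mpr (him.symm ▸ h)
      have a3 := Complex.neg_pi_lt_arg w
      have a4 := Complex.neg_pi_lt_arg (r - (Real.cos θ : ℂ))
      constructor <;> linarith
  generalize r - (Real.cos θ : ℂ) = x at *
  generalize 1 - w⁻¹ * Complex.exp (θ * I) = A at *
  generalize 1 - w⁻¹ * Complex.exp (((-θ : ℝ) : ℂ) * I) = B at *
  have hAB : A * B ≠ 0 := by
    intro h
    rw [h, mul_zero] at hfac
    exact hne hfac
  have hA0 := left_ne_zero_of_mul hAB
  have hB0 := right_ne_zero_of_mul hAB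
  have hexp : Complex.exp ((Complex.log w - Real.log 2) + (Complex.log A + Complex.log B))
      = Complex.exp (Complex.log x) := by
    rw [Complex.exp_add, Complex.exp_sub, Complex.exp_add, Complex.exp_log hw0,
      Complex.exp_log hA0, Complex.exp_log hB0, Complex.exp_log hne, ← Complex.ofReal_exp,
      Real.exp_log (by norm_num), hfac]
    norm_num
  obtain ⟨n, hn'⟩ := Complex.exp_eq_exp_iff_exists_int.mp hexp
  have him := congrArg Complex.im hn'
  have hI : ((n : ℂ) * (2 * (π : ℂ) * I)).im = n * (2 * π) := by
    rw [show (n : ℂ) * (2 * (π : ℂ) * I) = ((n * (2 * π) : ℝ) : ℂ) * I by push_cast; ring]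
    rw [Complex.im_ofReal_mul, Complex.I_im, mul_one]
  rw [Complex.add_im, Complex.sub_im, Complex.add_im, Complex.add_im, hI, Complex.ofReal_im] at him
  simp only [Complex.log_im] at him
  have hpi := Real.pi_pos
  rw [abs_lt] at hA hB
  rw [abs_le] at hargs
  have hn1 : (n : ℝ) < 1 := by
    by_contra h
    push Not at h
    nlinarith
  have hn2 : (-1 : ℝ) < n := by
    by_contra h
    push Not at h
    nlinarith
  have hn0 : n = 0 := by
    have b1 : n < 1 := by exact_mod_cast hn1
    have b2 : -1 < n := by exact_mod_cast hn2
    omega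
  rw [hn', hn0]
  simp

/-- For every complex number `r`,
`(1/(2π)) ∫_{-π}^{π} Log(r - cos θ) dθ = Log(r + √(r+1)·√(r-1)) - log 2`. -/
theorem integral_complex_log_sub_cos (r : ℂ) :
    (1 / (2 * (π : ℂ))) * ∫ θ in (-π)..π, Complex.log (r - Real.cos θ) =
      Complex.log (r + csqrt (r + 1) * csqrt (r - 1)) - Real.log 2 := by
  obtain ⟨w, hw⟩ : ∃ w, w = r + csqrt (r + 1) * csqrt (r - 1) := ⟨_, rfl⟩
  obtain ⟨h1, h2, h3, h4⟩ := w_props r w hw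
  rw [← hw]
  have hinv : ‖w⁻¹‖ ≤ 1 := by rw [norm_inv]; exact inv_le_one_of_one_le₀ h1
  have hcongr : ∫ θ in (-π)..π, Complex.log (r - Real.cos θ) =
      ∫ θ in (-π)..π, ((Complex.log w - Real.log 2) +
      (Complex.log (1 - w⁻¹ * Complex.exp (θ * I)) +
        Complex.log (1 - w⁻¹ * Complex.exp (((-θ : ℝ) : ℂ) * I)))) := by
    apply intervalIntegral.integral_congr_ae
    filter_upwards [aux_ae r] with θ hθ _
    exact aux_pointwise r w h1 h2 h3 h4 θ hθ
  have i1 := aux_log_int w⁻¹ (-π) π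
  have i2 : IntervalIntegrable
      (fun θ : ℝ => Complex.log (1 - w⁻¹ * Complex.exp (((-θ : ℝ) : ℂ) * I))) volume (-π) π := by
    have := (aux_log_int w⁻¹ (- -π) (-π)).comp_sub_left 0
    simpa only [zero_sub, neg_neg] using this
  have z1 := aux_log_zero w⁻¹ hinv
  have z2 : ∫ θ in (-π)..π, Complex.log (1 - w⁻¹ * Complex.exp (((-θ : ℝ) : ℂ) * I)) = 0 := by
    rw [intervalIntegral.integral_comp_neg
      (fun θ : ℝ => Complex.log (1 - w⁻¹ * Complex.exp ((θ : ℂ) * I))), neg_neg]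
    exact z1
  rw [hcongr, intervalIntegral.integral_add (by simp) (i1.add i2),
    intervalIntegral.integral_add i1 i2, z1, z2, intervalIntegral.integral_const]
  have hpi : (π : ℂ) ≠ 0 := by exact_mod_cast Real.pi_ne_zero
  rw [show π - -π = 2 * π by ring, Complex.real_smul]
  push_cast
  field_simp
  ring
end

section
/- For every real number r with -1 ≤ r ≤ 1, ∫_{-π}^{π} log|r - cos θ| dθ = -2π·log 2, where log is the real natural logarithm. -/
open Real MeasureTheory intervalIntegral

lemma aux_periodic_s2 : Function.Periodic (fun x => Real.log (Real.sin x)) π := by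
  intro x
  simp [Real.sin_add_pi]

lemma aux_int (φ : ℝ) :
    ∫ θ in (-π)..π, Real.log (Real.sin (θ / 2 + φ)) = -2 * π * Real.log 2 := by
  rw [intervalIntegral.integral_comp_div_add (fun x => Real.log (Real.sin x)) two_ne_zero]
  have h := aux_periodic_s2.intervalIntegral_add_eq (-π / 2 + φ) 0
  rw [show -π / 2 + φ + π = π / 2 + φ by ring, zero_add, integral_log_sin_zero_pi] at h
  rw [h, smul_eq_mul]
  ring

lemma aux_integrable (φ : ℝ) :
    IntervalIntegrable (fun θ => Real.log (Real.sin (θ / 2 + φ))) volume (-π) π := by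
  apply MeromorphicOn.intervalIntegrable_log
  intro x _
  apply AnalyticAt.meromorphicAt
  fun_prop

lemma aux_ne (φ : ℝ) :
    (fun θ : ℝ => Real.sin (θ / 2 + φ)) ⁻¹' {0}ᶜ ∈ Filter.codiscrete ℝ := by
  have h : AnalyticOnNhd ℝ (fun θ : ℝ => Real.sin (θ / 2 + φ)) Set.univ := by
    intro x _
    fun_prop
  apply h.preimage_zero_mem_codiscrete (x := π - 2 * φ)
  rw [show (π - 2 * φ) / 2 + φ = π / 2 by ring]
  simp

/-- For every real `r` with `-1 ≤ r ≤ 1`,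
`∫_{-π}^{π} log|r - cos θ| dθ = -2π log 2`. -/
theorem integral_log_abs_sub_cos_of_mem_Icc (r : ℝ) (hr : -1 ≤ r) (hr' : r ≤ 1) :
    ∫ θ in (-π)..π, Real.log |r - Real.cos θ| = -2 * π * Real.log 2 := by
  obtain ⟨φ, rfl⟩ : ∃ φ, Real.cos φ = r := ⟨_, Real.cos_arccos hr hr'⟩
  have h : ∫ θ in (-π)..π, Real.log |Real.cos φ - Real.cos θ| =
      ∫ θ in (-π)..π, (Real.log 2 + Real.log (Real.sin (θ / 2 + φ / 2))
        + Real.log (Real.sin (θ / 2 + -φ / 2))) := by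
    apply intervalIntegral.integral_congr_codiscreteWithin
    apply Filter.codiscreteWithin_mono (Set.subset_univ _)
    filter_upwards [aux_ne (φ / 2), aux_ne (-φ / 2)] with θ h₁ h₂
    have h₁' : Real.sin (θ / 2 + φ / 2) ≠ 0 := h₁
    have h₂' : Real.sin (θ / 2 + -φ / 2) ≠ 0 := h₂
    rw [Real.log_abs, ← Real.log_mul two_ne_zero h₁',
      ← Real.log_mul (mul_ne_zero two_ne_zero h₁') h₂', Real.cos_sub_cos,
      show (φ - θ) / 2 = -(θ / 2 + -φ / 2) by ring, Real.sin_neg,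
      show (φ + θ) / 2 = θ / 2 + φ / 2 by ring]
    congr 1
    ring
  rw [h, intervalIntegral.integral_add (intervalIntegrable_const.add (aux_integrable _))
    (aux_integrable _), intervalIntegral.integral_add intervalIntegrable_const (aux_integrable _),
    aux_int, aux_int, intervalIntegral.integral_const, smul_eq_mul]
  ring
end
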